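/- Let P be a partially ordered set. If no subset of P (with the induced order) is order-isomorphic to any of the posets F_1,...,F_8 or to any of their duals F_1^d,...,F_8^d, then P is hereditarily reversible, i.e., every subset of P with the induced order is reversible. -/

import Mathlib

/-- A preordered set is *reversible* if every order-preserving bijection of it
onto itself has order-preserving inverse. -/
def Reversible (P : Type*) [Preorder P] : Prop :=
  ∀ f : P ≃ P, Monotone f → Monotone f.symm

/-- `D_∞`, the countably infinite antichain. -/
def Dinf : Type := ℕ

instance : PartialOrder Dinf where
  le a b := a = b
  le_refl _ := rfl
  le_trans _ _ _ h₁ h₂ := Eq.trans h₁ h₂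
  le_antisymm _ _ h _ := h

/-- `F₁ = D_∞ ⊔ ω`. -/
abbrev F1 : Type := Dinf ⊕ ℕ

/-- `F₂ = (D₁ ⊕ D_∞) ⊔ D_∞`. -/
abbrev F2 : Type := (PUnit ⊕ₗ Dinf) ⊕ Dinf

/-- `F₃ = D_∞ ⊔ (countably many two-element chains)`. -/
abbrev F3 : Type := Dinf ⊕ (Dinf × Bool)

/-- `F₄ = D_∞ ⊕ ω`. -/
abbrev F4 : Type := Dinf ⊕ₗ ℕ

/-- `F₅ = (D₁ ⊔ ω^d) ⊕ ω`. -/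
abbrev F5 : Type := (PUnit ⊕ ℕᵒᵈ) ⊕ₗ ℕ

/-- The poset `L` on `ℕ × {0,1}` with `(i,x) < (j,y)` iff `i > j`. -/
def L6 : Type := ℕ × Bool

/-- The order relation of `L6`. -/
def L6.le (a b : ℕ × Bool) : Prop := b.1 < a.1 ∨ a = b

instance : PartialOrder L6 where
  le := L6.le
  le_refl _ := Or.inr rfl
  le_trans a b c hab hbc := by
    rcases hab with h | h
    · rcases hbc with h' | h'
      · exact Or.inl (h'.trans h)
      · exact Or.inl (h' ▸ h)
    · rcases hbc with h' | h'
      · exact Or.inl (h ▸ h')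
      · exact Or.inr (h.trans h')
  le_antisymm a b hab hba := by
    rcases hab with h | h
    · rcases hba with h' | h'
      · exact absurd (h.trans h') (lt_irrefl _)
      · exact h'.symm
    · exact h

/-- `F₆ = L ⊕ ω`. -/
abbrev F6 : Type := L6 ⊕ₗ ℕ

/-- `F₇`: a chain `c₀ < c₁ < ⋯` (encoded `Sum.inr i = cᵢ`) together with pairwise
incomparable elements `a₁, a₂, …` (encoded `Sum.inl j = a_{j+1}`), where
`a_j < c_i` iff `i ≥ j`, and no other comparabilities. -/
def F7 : Type := ℕ ⊕ ℕ

/-- The order relation of `F₇`: `a_{j+1} ≤ cᵢ` iff `i ≥ j + 1`. -/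
def F7.le : F7 → F7 → Prop
  | Sum.inl j, Sum.inl j' => j = j'
  | Sum.inl j, Sum.inr i => j + 1 ≤ i
  | Sum.inr _, Sum.inl _ => False
  | Sum.inr i, Sum.inr i' => i ≤ i'

theorem F7.le_refl (x : F7) : F7.le x x := by cases x <;> simp [F7.le]
theorem F7.le_trans (x y z : F7) : F7.le x y → F7.le y z → F7.le x z := by
  cases x <;> cases y <;> cases z <;> simp [F7.le] <;> omega
theorem F7.le_antisymm (x y : F7) : F7.le x y → F7.le y x → x = y := by
  cases x <;> cases y <;> simp [F7.le] <;> intro h h' <;> exact congrArg _ (by omega)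

instance : PartialOrder F7 where
  le := F7.le
  le_refl := F7.le_refl
  le_trans := F7.le_trans
  le_antisymm := F7.le_antisymm

/-- `F₈`: on `{aᵢ : i ∈ ℤ} ∪ {bᵢ : i ∈ ℤ}` (encoded `Sum.inl i = aᵢ`,
`Sum.inr j = b_j`), the `aᵢ` pairwise incomparable, the `bᵢ` pairwise
incomparable, and `aᵢ < b_j` iff `i > 0` or `j ≠ i`. -/
def F8 : Type := ℤ ⊕ ℤ

/-- The order relation of `F₈`. -/
def F8.le : F8 → F8 → Prop
  | Sum.inl i, Sum.inl i' => i = i'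
  | Sum.inl i, Sum.inr j => 0 < i ∨ j ≠ i
  | Sum.inr _, Sum.inl _ => False
  | Sum.inr j, Sum.inr j' => j = j'

theorem F8.le_refl (x : F8) : F8.le x x := by cases x <;> simp [F8.le]
theorem F8.le_trans (x y z : F8) : F8.le x y → F8.le y z → F8.le x z := by
  cases x <;> cases y <;> cases z <;> simp [F8.le] <;> omega
theorem F8.le_antisymm (x y : F8) : F8.le x y → F8.le y x → x = y := by
  cases x <;> cases y <;> simp [F8.le] <;> intro h h' <;> exact congrArg _ (by omega)

instance : PartialOrder F8 where
  le := F8.le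
  le_refl := F8.le_refl
  le_trans := F8.le_trans
  le_antisymm := F8.le_antisymm

/-- `P` contains a subset (with the induced order) order-isomorphic to `F`. -/
def ContainsCopy (F : Type*) (P : Type*) [LE F] [LE P] : Prop :=
  ∃ S : Set P, Nonempty (F ≃o S)

theorem ContainsCopy.of_map {F P : Type*} [LE F] [PartialOrder P] (φ : F → P)
    (anti : ∀ a b : F, a ≤ b → b ≤ a → a = b)
    (h : ∀ a b, φ a ≤ φ b ↔ a ≤ b) : ContainsCopy F P := by
  have hinj : Function.Injective φ := fun a b hab =>
    anti _ _ ((h a b).1 hab.le) ((h b a).1 hab.ge)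
  exact ⟨Set.range φ, ⟨⟨Equiv.ofInjective φ hinj, fun {a b} => h a b⟩⟩⟩

theorem ContainsCopy.of_le_iff {F P : Type*} [PartialOrder F] [PartialOrder P] (φ : F → P)
    (h : ∀ a b, φ a ≤ φ b ↔ a ≤ b) : ContainsCopy F P :=
  .of_map φ (fun _ _ => le_antisymm) h

theorem ContainsCopy.dual {F P : Type*} [PartialOrder F] [PartialOrder P]
    (h : ContainsCopy F P) : ContainsCopy Fᵒᵈ Pᵒᵈ := by
  obtain ⟨S, ⟨e⟩⟩ := h
  exact .of_le_iff (fun a => OrderDual.toDual (e (OrderDual.ofDual a) : P))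
    fun a b => e.le_iff_le (x := OrderDual.ofDual b) (y := OrderDual.ofDual a)

/-- The elements of the family `a` are pairwise incomparable. -/
def AntichainSeq {ι P : Type*} [LE P] (a : ι → P) : Prop := ∀ i j, a i ≤ a j → i = j

section Copies

variable {P : Type*} [PartialOrder P]

theorem AntichainSeq.le_iff {ι : Type*} {a : ι → P} (h : AntichainSeq a) {i j : ι} :
    a i ≤ a j ↔ i = j := ⟨h i j, fun e => e ▸ le_rfl⟩

theorem AntichainSeq.comp {ι κ : Type*} {a : ι → P} (h : AntichainSeq a) {g : κ → ι}
    (hg : Function.Injective g) : AntichainSeq (a ∘ g) := fun _ _ hij => hg (h _ _ hij)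

theorem Dinf.le_iff {i j : Dinf} : i ≤ j ↔ i = j := Iff.rfl

theorem containsCopy_F1 {a c : ℕ → P} (ha : AntichainSeq a) (hc : StrictMono c)
    (hac : ∀ i j, ¬ a i ≤ c j) (hca : ∀ i j, ¬ c i ≤ a j) : ContainsCopy F1 P := by
  refine .of_le_iff (Sum.elim (fun d : Dinf => a d) c) ?_
  rintro (i | i) (j | j)
  · exact ha.le_iff.trans (Sum.inl_le_inl_iff.trans Dinf.le_iff).symm
  · simpa using hac i j
  · simpa using hca i j
  · simpa using hc.le_iff_le

theorem containsCopy_F2 {p : P} {a b : ℕ → P} (ha : AntichainSeq a) (hb : AntichainSeq b)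
    (hab : ∀ i j, ¬ a i ≤ b j) (hba : ∀ i j, ¬ b i ≤ a j) (hpb : ∀ i, p < b i)
    (hpa : ∀ i, ¬ p ≤ a i) (hap : ∀ i, ¬ a i ≤ p) : ContainsCopy F2 P := by
  refine .of_le_iff
    (Sum.elim (fun s => Sum.elim (fun _ => p) (fun d : Dinf => b d) (ofLex s))
      (fun d : Dinf => a d)) ?_
  rintro ((i | i) | i) ((j | j) | j)
  · exact iff_of_true le_rfl (by rfl)
  · exact iff_of_true (hpb j).le (Sum.inl_le_inl_iff.2 (Sum.Lex.inl_le_inr i j))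
  · exact iff_of_false (hpa j) Sum.not_inl_le_inr
  · exact iff_of_false (hpb i).not_ge fun h =>
      Sum.Lex.not_inr_le_inl (Sum.inl_le_inl_iff.1 h)
  · exact hb.le_iff.trans
      (Sum.inl_le_inl_iff.trans (Sum.Lex.inr_le_inr_iff.trans Dinf.le_iff)).symm
  · exact iff_of_false (hba i j) Sum.not_inl_le_inr
  · exact iff_of_false (hap i) Sum.not_inr_le_inl
  · exact iff_of_false (hab i j) Sum.not_inr_le_inl
  · exact ha.le_iff.trans (Sum.inr_le_inr_iff.trans Dinf.le_iff).symm

theorem containsCopy_F3 {a x y : ℕ → P} (ha : AntichainSeq a) (hx : AntichainSeq x)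
    (hy : AntichainSeq y) (hax : ∀ i j, ¬ a i ≤ x j) (hxa : ∀ i j, ¬ x i ≤ a j)
    (hay : ∀ i j, ¬ a i ≤ y j) (hya : ∀ i j, ¬ y i ≤ a j)
    (hxy : ∀ i j, x i ≤ y j ↔ i = j) (hyx : ∀ i j, ¬ y i ≤ x j) : ContainsCopy F3 P := by
  refine .of_le_iff (Sum.elim (fun d : Dinf => a d)
    (fun q : Dinf × Bool => if q.2 then y q.1 else x q.1)) ?_
  rintro (i | ⟨i, _ | _⟩) (j | ⟨j, _ | _⟩)
  · exact ha.le_iff.trans (Sum.inl_le_inl_iff.trans Dinf.le_iff).symm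
  · simpa using hax i j
  · simpa using hay i j
  · simpa using hxa i j
  · exact Iff.trans (b := @Eq Dinf i j) hx.le_iff (by simp [Prod.mk_le_mk, Dinf.le_iff])
  · exact Iff.trans (b := @Eq Dinf i j) (hxy i j) (by simp [Prod.mk_le_mk, Dinf.le_iff])
  · simpa using hya i j
  · exact iff_of_false (hyx i j) (by simp [Prod.mk_le_mk])
  · exact Iff.trans (b := @Eq Dinf i j) hy.le_iff (by simp [Prod.mk_le_mk, Dinf.le_iff])

theorem containsCopy_F4 {a c : ℕ → P} (ha : AntichainSeq a) (hc : StrictMono c)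
    (hac : ∀ i, a i < c 0) : ContainsCopy F4 P := by
  have hac' (i j) : a i < c j := (hac i).trans_le (hc.monotone j.zero_le)
  refine .of_le_iff (fun s => Sum.elim (fun d : Dinf => a d) c (ofLex s)) ?_
  rintro (i | i) (j | j)
  · exact ha.le_iff.trans (Sum.Lex.inl_le_inl_iff.trans Dinf.le_iff).symm
  · exact iff_of_true (hac' i j).le (Sum.Lex.inl_le_inr i j)
  · exact iff_of_false (hac' j i).not_ge Sum.Lex.not_inr_le_inl
  · exact hc.le_iff_le.trans Sum.Lex.inr_le_inr_iff.symm

theorem containsCopy_F5 {p : P} {d c : ℕ → P} (hd : StrictAnti d) (hc : StrictMono c)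
    (hpd : ∀ i, ¬ p ≤ d i) (hdp : ∀ i, ¬ d i ≤ p) (hpc : p < c 0) (hdc : d 0 < c 0) :
    ContainsCopy F5 P := by
  have hpc' (j) : p < c j := hpc.trans_le (hc.monotone j.zero_le)
  have hdc' (i j) : d i < c j :=
    (hd.antitone i.zero_le).trans_lt (hdc.trans_le (hc.monotone j.zero_le))
  refine .of_le_iff (fun s => Sum.elim
    (Sum.elim (fun _ => p) (fun i => d (OrderDual.ofDual i))) c (ofLex s)) ?_
  rintro ((i | i) | i) ((j | j) | j)
  · exact iff_of_true le_rfl (by rfl)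
  · exact iff_of_false (hpd j) fun h => Sum.not_inl_le_inr (Sum.Lex.inl_le_inl_iff.1 h)
  · exact iff_of_true (hpc' j).le (Sum.Lex.inl_le_inr _ _)
  · exact iff_of_false (hdp i) fun h => Sum.not_inr_le_inl (Sum.Lex.inl_le_inl_iff.1 h)
  · exact hd.le_iff_ge.trans (OrderDual.ofDual_le_ofDual.trans
      (Sum.Lex.inl_le_inl_iff.trans Sum.inr_le_inr_iff).symm)
  · exact iff_of_true (hdc' i j).le (Sum.Lex.inl_le_inr _ _)
  · exact iff_of_false (hpc' i).not_ge Sum.Lex.not_inr_le_inl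
  · exact iff_of_false (hdc' j i).not_ge Sum.Lex.not_inr_le_inl
  · exact hc.le_iff_le.trans Sum.Lex.inr_le_inr_iff.symm

theorem containsCopy_F6 {a b c : ℕ → P} (ha : StrictAnti a) (hb : StrictAnti b)
    (hc : StrictMono c) (hab : ∀ i j, a i ≤ b j ↔ j < i) (hba : ∀ i j, b i ≤ a j ↔ j < i)
    (hac : a 0 < c 0) (hbc : b 0 < c 0) : ContainsCopy F6 P := by
  have hac' (i j) : a i < c j :=
    (ha.antitone i.zero_le).trans_lt (hac.trans_le (hc.monotone j.zero_le))
  have hbc' (i j) : b i < c j :=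
    (hb.antitone i.zero_le).trans_lt (hbc.trans_le (hc.monotone j.zero_le))
  have hL (q r : L6) : (if q.2 then b q.1 else a q.1) ≤ (if r.2 then b r.1 else a r.1) ↔
      q ≤ r := by
    obtain ⟨i, _ | _⟩ := q <;> obtain ⟨j, _ | _⟩ := r
    · exact ha.le_iff_ge.trans (le_iff_lt_or_eq.trans (or_congr_right
        ⟨fun h => congrArg (Prod.mk · false) h.symm, fun h => (congrArg Prod.fst h).symm⟩))
    · exact (hab i j).trans (or_iff_left fun h => Bool.noConfusion (congrArg Prod.snd h)).symm
    · exact (hba i j).trans (or_iff_left fun h => Bool.noConfusion (congrArg Prod.snd h)).symm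
    · exact hb.le_iff_ge.trans (le_iff_lt_or_eq.trans (or_congr_right
        ⟨fun h => congrArg (Prod.mk · true) h.symm, fun h => (congrArg Prod.fst h).symm⟩))
  have hLc (q : L6) (j : ℕ) : (if q.2 then b q.1 else a q.1) < c j := by
    split_ifs <;> simp [hac', hbc']
  refine .of_le_iff (fun s => Sum.elim
    (fun q : L6 => if q.2 then b q.1 else a q.1) c (ofLex s)) ?_
  rintro (i | i) (j | j)
  · exact (hL i j).trans Sum.Lex.inl_le_inl_iff.symm
  · exact iff_of_true (hLc i j).le (Sum.Lex.inl_le_inr _ _)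
  · exact iff_of_false (hLc j i).not_ge Sum.Lex.not_inr_le_inl
  · exact hc.le_iff_le.trans Sum.Lex.inr_le_inr_iff.symm

theorem containsCopy_F7 {a c : ℕ → P} (ha : AntichainSeq a) (hc : StrictMono c)
    (hac : ∀ i j, a i ≤ c j ↔ i ≤ j) (hca : ∀ i j, ¬ c i ≤ a j) : ContainsCopy F7 P := by
  refine .of_le_iff (F := F7) (Sum.elim (fun j => a (j + 1)) c) ?_
  rintro (i | i) (j | j)
  · exact ha.le_iff.trans Nat.succ_inj
  · exact hac _ _
  · exact iff_of_false (hca _ _) id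
  · exact hc.le_iff_le

theorem containsCopy_F8 {a b : ℤ → P} (ha : AntichainSeq a) (hb : AntichainSeq b)
    (hab : ∀ i j, a i ≤ b j ↔ 0 < i ∨ j ≠ i) (hba : ∀ i j, ¬ b i ≤ a j) :
    ContainsCopy F8 P := by
  refine .of_le_iff (F := F8) (Sum.elim a b) ?_
  rintro (i | i) (j | j)
  · exact ha.le_iff
  · exact hab _ _
  · exact iff_of_false (hba _ _) id
  · exact hb.le_iff

end Copies

/-- No subset of `P` is isomorphic to one of `F₁, …, F₈` or their duals. -/
structure NoForbidden (P : Type*) [PartialOrder P] : Prop where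
  f1 : ¬ ContainsCopy F1 P
  f1d : ¬ ContainsCopy F1ᵒᵈ P
  f2 : ¬ ContainsCopy F2 P
  f2d : ¬ ContainsCopy F2ᵒᵈ P
  f3 : ¬ ContainsCopy F3 P
  f3d : ¬ ContainsCopy F3ᵒᵈ P
  f4 : ¬ ContainsCopy F4 P
  f4d : ¬ ContainsCopy F4ᵒᵈ P
  f5 : ¬ ContainsCopy F5 P
  f5d : ¬ ContainsCopy F5ᵒᵈ P
  f6 : ¬ ContainsCopy F6 P
  f6d : ¬ ContainsCopy F6ᵒᵈ P
  f7 : ¬ ContainsCopy F7 P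
  f7d : ¬ ContainsCopy F7ᵒᵈ P
  f8 : ¬ ContainsCopy F8 P
  f8d : ¬ ContainsCopy F8ᵒᵈ P

theorem NoForbidden.dual {P : Type*} [PartialOrder P] (h : NoForbidden P) :
    NoForbidden Pᵒᵈ where
  f1 := fun H => h.f1d H.dual
  f1d := fun H => h.f1 H.dual
  f2 := fun H => h.f2d H.dual
  f2d := fun H => h.f2 H.dual
  f3 := fun H => h.f3d H.dual
  f3d := fun H => h.f3 H.dual
  f4 := fun H => h.f4d H.dual
  f4d := fun H => h.f4 H.dual
  f5 := fun H => h.f5d H.dual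
  f5d := fun H => h.f5 H.dual
  f6 := fun H => h.f6d H.dual
  f6d := fun H => h.f6 H.dual
  f7 := fun H => h.f7d H.dual
  f7d := fun H => h.f7 H.dual
  f8 := fun H => h.f8d H.dual
  f8d := fun H => h.f8 H.dual

theorem ContainsCopy.of_subset {F P : Type*} [PartialOrder F] [PartialOrder P] {S : Set P}
    (h : ContainsCopy F S) : ContainsCopy F P := by
  obtain ⟨T, ⟨e⟩⟩ := h
  exact .of_le_iff (fun a => ((e a : S) : P)) fun a b => e.le_iff_le

theorem NoForbidden.subset {P : Type*} [PartialOrder P] (h : NoForbidden P) (S : Set P) :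
    NoForbidden S where
  f1 := fun H => h.f1 H.of_subset
  f1d := fun H => h.f1d H.of_subset
  f2 := fun H => h.f2 H.of_subset
  f2d := fun H => h.f2d H.of_subset
  f3 := fun H => h.f3 H.of_subset
  f3d := fun H => h.f3d H.of_subset
  f4 := fun H => h.f4 H.of_subset
  f4d := fun H => h.f4d H.of_subset
  f5 := fun H => h.f5 H.of_subset
  f5d := fun H => h.f5d H.of_subset
  f6 := fun H => h.f6 H.of_subset
  f6d := fun H => h.f6d H.of_subset
  f7 := fun H => h.f7 H.of_subset
  f7d := fun H => h.f7d H.of_subset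
  f8 := fun H => h.f8 H.of_subset
  f8d := fun H => h.f8d H.of_subset

/-- A relation on `ℕ` in which every element has finitely many successors is avoided by an
infinite subset of `ℕ`. -/
theorem exists_strictMono_forall_lt_not {Q : ℕ → ℕ → Prop} (hQ : ∀ i, {j | Q i j}.Finite) :
    ∃ g : ℕ → ℕ, StrictMono g ∧ ∀ i j, i < j → ¬ Q (g i) (g j) := by
  have hN (i) : ∃ N, i < N ∧ ∀ j, N ≤ j → ¬ Q i j := by
    obtain ⟨N, hN⟩ := (hQ i).bddAbove
    exact ⟨max i N + 1, by omega, fun j hj h => by have := hN h; omega⟩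
  choose N hiN hN using hN
  have hg : StrictMono fun n => N^[n] 0 := strictMono_nat_of_lt_succ fun n => by
    simpa [Function.iterate_succ_apply'] using hiN _
  refine ⟨_, hg, fun i j hij => hN _ _ ?_⟩
  simpa [Function.iterate_succ_apply'] using hg.monotone (Nat.succ_le_of_lt hij)

theorem exists_strictMono_of_infinite {p : ℕ → Prop} (h : {k | p k}.Infinite) :
    ∃ e : ℕ → ℕ, StrictMono e ∧ ∀ k, p (e k) :=
  ⟨Nat.nth p, Nat.nth_strictMono h, Nat.nth_mem_of_infinite h⟩

namespace NoForbidden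

variable {P : Type*} [PartialOrder P]

/-- An infinite antichain and an ascending chain, no element of which is below an element of the
antichain, contain a copy of `F₁`, `F₄` or `F₇`. -/
theorem false_of_antichain_chain (hP : NoForbidden P) {a c : ℕ → P} (ha : AntichainSeq a)
    (hc : StrictMono c) (hca : ∀ i j, ¬ c i ≤ a j) : False := by
  by_cases hm : ∃ m, {k | a k ≤ c m}.Infinite
  · obtain ⟨m, hm⟩ := hm
    obtain ⟨e, he, hle⟩ := exists_strictMono_of_infinite hm
    exact hP.f4 (containsCopy_F4 (c := fun i => c (m + i)) (ha.comp he.injective)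
      (hc.comp (add_right_strictMono (a := m))) fun i =>
        lt_of_le_not_ge (hle i) (hca _ _))
  have hfin (m) : {k | a k ≤ c m}.Finite := Set.not_infinite.1 fun h => hm ⟨m, h⟩
  by_cases hbelow : {k | ∃ m, a k ≤ c m}.Infinite
  · obtain ⟨e, he, hle⟩ := exists_strictMono_of_infinite hbelow
    choose M hM using hle
    obtain ⟨g, hg, hgQ⟩ := exists_strictMono_forall_lt_not
      (Q := fun i j => a (e j) ≤ c (M i))
      fun i => (hfin (M i)).preimage he.injective.injOn
    have hMg : StrictMono fun i => M (g i) := fun i j hij => by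
      by_contra! hle
      exact hgQ i j hij ((hM _).trans (hc.monotone hle))
    refine hP.f7 (containsCopy_F7 (a := fun i => a (e (g i))) (c := fun i => c (M (g i)))
      (ha.comp (he.injective.comp hg.injective)) (hc.comp hMg) (fun i j => ⟨fun h => ?_,
        fun h => (hM _).trans (hc.monotone (hMg.monotone h))⟩) fun i j => hca _ _)
    by_contra! hlt
    exact hgQ j i hlt h
  · have hinf : {k | ∀ m, ¬ a k ≤ c m}.Infinite := by
      simpa [Set.compl_ofPred] using (Set.not_infinite.1 hbelow).infinite_compl
    obtain ⟨e, he, hle⟩ := exists_strictMono_of_infinite hinf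
    exact hP.f1 (containsCopy_F1 (ha.comp he.injective) hc hle fun i j => hca _ _)

theorem exists_le_of_ladder (hP : NoForbidden P) {a b c : ℕ → P}
    (hb : StrictAnti b) (hc : StrictMono c) (hab : ∀ i, ¬ a i ≤ b i)
    (hac : ∀ i, a i < c 0) (hbc : b 0 < c 0) (i : ℕ) : ∃ j, b j ≤ a i := by
  by_contra! h
  exact hP.f5 (containsCopy_F5 (p := a i) (d := fun k => b (i + k))
    (hb.comp_strictMono (add_right_strictMono (a := i))) hc
    (fun k hk => hab i (hk.trans (hb.antitone (Nat.le_add_right i k)))) (fun k => h _)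
    (hac i) ((hb.antitone (Nat.zero_le _)).trans_lt hbc))

/-- Two descending chains with incomparable corresponding elements, lying below an ascending
chain, contain a copy of `F₅` or `F₆`. -/
theorem false_of_ladder (hP : NoForbidden P) {a b c : ℕ → P} (ha : StrictAnti a)
    (hb : StrictAnti b) (hc : StrictMono c) (hab : ∀ i, ¬ a i ≤ b i) (hba : ∀ i, ¬ b i ≤ a i)
    (hac : a 0 < c 0) (hbc : b 0 < c 0) : False := by
  have h1 := hP.exists_le_of_ladder hb hc hab
    (fun i => (ha.antitone i.zero_le).trans_lt hac) hbc
  have h2 := hP.exists_le_of_ladder ha hc hba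
    (fun i => (hb.antitone i.zero_le).trans_lt hbc) hac
  obtain ⟨g, hg, hgQ⟩ := exists_strictMono_forall_lt_not
    (Q := fun i j => ¬ b j ≤ a i ∨ ¬ a j ≤ b i) fun i => by
      obtain ⟨j, hj⟩ := h1 i
      obtain ⟨k, hk⟩ := h2 i
      refine (Set.finite_lt_nat (max j k)).subset fun l hl => ?_
      by_contra hle
      have hle : max j k ≤ l := not_lt.1 hle
      exact hl.elim (· ((hb.antitone (by omega)).trans hj))
        (· ((ha.antitone (by omega)).trans hk))
  simp only [not_or, not_not] at hgQ
  refine hP.f6 (containsCopy_F6 (ha.comp_strictMono hg) (hb.comp_strictMono hg) hc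
    (fun i j => ⟨fun h => ?_, fun h => (hgQ j i h).2⟩)
    (fun i j => ⟨fun h => ?_, fun h => (hgQ j i h).1⟩)
    ((ha.antitone (Nat.zero_le _)).trans_lt hac) ((hb.antitone (Nat.zero_le _)).trans_lt hbc))
  · by_contra! hle
    exact hab _ (h.trans (hb.antitone (hg.monotone hle)))
  · by_contra! hle
    exact hba _ (h.trans (ha.antitone (hg.monotone hle)))

end NoForbidden

/-- Comparabilities from `x` to `y` are preserved by simultaneous positive shifts of the
indices. -/
structure Shifts {P : Type*} [PartialOrder P] (x y : ℤ → P) : Prop where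
  le : ∀ i j k, 0 ≤ k → x i ≤ y j → x (i + k) ≤ y (j + k)
  lt : ∀ i j k, 0 ≤ k → x i < y j → x (i + k) < y (j + k)

section

variable {P : Type*} [PartialOrder P] {x y w z : ℤ → P}

theorem Shifts.dual (h : Shifts x y) : Shifts (OrderDual.toDual ∘ y) (OrderDual.toDual ∘ x) :=
  ⟨fun i j k hk hij => h.le j i k hk hij, fun i j k hk hij => h.lt j i k hk hij⟩

theorem Shifts.comp_affine (h : Shifts x y) (c d : ℤ) (hd : 0 ≤ d) :
    Shifts (fun n => x (c + d * n)) (fun n => y (c + d * n)) where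
  le i j k hk hij := by
    simpa [mul_add, add_assoc] using h.le _ _ (d * k) (mul_nonneg hd hk) hij
  lt i j k hk hij := by
    simpa [mul_add, add_assoc] using h.lt _ _ (d * k) (mul_nonneg hd hk) hij

/-- An orbit that becomes ascending is an ascending chain. -/
theorem NoForbidden.strictMono_of_shifts (hP : NoForbidden P) (hw : Shifts w w)
    (h01 : w 0 < w 1) : StrictMono w := by
  refine strictMono_int_of_lt_succ ?_
  by_contra! hn
  obtain ⟨n, hn⟩ := hn
  have hpos : StrictMono fun k : ℕ => w k := strictMono_nat_of_lt_succ fun k => by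
    simpa [add_comm] using hw.lt 0 1 k (by positivity) h01
  have hle (i j) (hij : w i ≤ w j) : i ≤ j := by
    by_contra! hlt
    have := hw.le i j (|i| + |j|) (by positivity) hij
    have hi := neg_abs_le i
    have hj := neg_abs_le j
    have h' := hpos (show (j + (|i| + |j|)).toNat < (i + (|i| + |j|)).toNat by
      have := abs_nonneg i
      have := abs_nonneg j
      omega)
    simp only at h'
    rw [Int.toNat_of_nonneg (by have := abs_nonneg i; omega),
      Int.toNat_of_nonneg (by have := abs_nonneg j; omega)] at h'
    exact h'.not_ge this
  have hneg (i) (hi : i ≤ n) : ¬ w i ≤ w (i + 1) := fun h => by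
    have h' := hw.lt i (i + 1) (n - i) (by omega)
      (lt_of_le_not_ge h fun h'' => by have := hle _ _ h''; omega)
    rw [show i + (n - i) = n by ring, show i + 1 + (n - i) = n + 1 by ring] at h'
    exact hn h'
  obtain ⟨g, hg | hg⟩ := exists_increasing_or_nonincreasing_subseq (· > ·)
    fun k : ℕ => w (-k)
  · have hanti : StrictAnti fun k => w (-g k + g 0) := fun i j hij =>
      hw.lt _ _ _ (by positivity) (hg i j hij)
    have hanti' : StrictAnti fun k => w (-g k + g 0 + 1) := fun i j hij =>
      hw.lt _ _ _ zero_le_one (hanti hij)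
    obtain ⟨K, hK⟩ : ∃ K : ℕ, -(g K : ℤ) + g 0 ≤ n :=
      ⟨(g 0 - n).toNat, by have := g.strictMono.le_apply (x := (g 0 - n).toNat); omega⟩
    have hmono : StrictMono fun k : ℕ => K + k := add_right_strictMono
    refine hP.false_of_ladder (hanti.comp_strictMono hmono) (hanti'.comp_strictMono hmono)
      (c := fun k => w ((k + 2 : ℕ) : ℤ))
      (fun i j hij => hpos (by omega)) (fun i => hneg _ ?_)
      (fun i h => by have := hle _ _ h; omega) ?_ ?_
    · have := g.monotone (Nat.le_add_right K i)
      dsimp only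
      omega
    · refine (hanti.antitone (Nat.zero_le _)).trans_lt ?_
      simpa using hpos (show 0 < 2 by omega)
    · refine (hanti'.antitone (Nat.zero_le _)).trans_lt ?_
      simpa using hpos (show 1 < 2 by omega)
  · refine hP.false_of_antichain_chain (a := fun k => w (-g (k + 1))) (fun i j hij => ?_) hpos
      (fun i j h => ?_)
    · have h1 := hle _ _ hij
      by_contra hne
      have hlt : j < i := by
        by_contra! hji
        have := g.strictMono (show i + 1 < j + 1 by omega)
        omega
      exact hg (j + 1) (i + 1) (by omega) (lt_of_le_of_ne hij fun h => by
        have := hle _ _ h.ge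
        have := g.strictMono (show j + 1 < i + 1 by omega)
        omega)
    · have h1 := hle _ _ h
      have := g.strictMono (show 0 < j + 1 by omega)
      omega

end

/-- The indices of an orbit start at incomparable pairs and end in comparable ones. -/
structure Crossing {P : Type*} [PartialOrder P] (x y : ℤ → P) : Prop where
  shifts : Shifts x y
  shifts' : Shifts y x
  lt : ∀ n, 1 ≤ n → x n < y n
  not_le : ∀ n, n ≤ 0 → ¬ x n ≤ y n

section

variable {P : Type*} [PartialOrder P] {x y z : ℤ → P}

namespace Crossing

theorem dual (h : Crossing x y) : Crossing (OrderDual.toDual ∘ y) (OrderDual.toDual ∘ x) :=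
  ⟨h.shifts.dual, h.shifts'.dual, fun n hn => h.lt n hn, fun n hn => h.not_le n hn⟩

theorem not_ge (h : Crossing x y) (n : ℤ) : ¬ y n ≤ x n := fun hn =>
  (h.lt (n + (|n| + 1)) (by have := neg_abs_le n; omega)).not_ge
    (h.shifts'.le n n (|n| + 1) (by positivity) hn)

/-- A comparability `y j ≤ x i` yields comparabilities `y (j + k) < y (i + k)`. -/
theorem exists_lt_of_le (h : Crossing x y) {i j : ℤ} (hij : y j ≤ x i) :
    ∃ k, 1 ≤ i + k ∧ 1 ≤ j + k ∧ y (j + k) ≤ x (i + k) ∧ y (j + k) < y (i + k) := by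
  have hk : 0 ≤ |i| + |j| + 1 := by positivity
  have hi : 1 ≤ i + (|i| + |j| + 1) := by have := neg_abs_le i; have := abs_nonneg j; omega
  have hj : 1 ≤ j + (|i| + |j| + 1) := by have := neg_abs_le j; have := abs_nonneg i; omega
  have h1 := h.shifts'.le j i _ hk hij
  exact ⟨_, hi, hj, h1, h1.trans_lt (h.lt _ hi)⟩

end Crossing

theorem AntichainSeq.dual {ι : Type*} {a : ι → P} (h : AntichainSeq a) :
    AntichainSeq (OrderDual.toDual ∘ a) := fun i j hij => (h j i hij).symm

namespace NoForbidden

theorem false_of_const_const (h : Crossing x y) (hx : ∀ i j, x i = x j)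
    (hy : ∀ i j, y i = y j) : False :=
  h.not_le 0 le_rfl (by rw [hx 0 1, hy 0 1]; exact (h.lt 1 le_rfl).le)

theorem false_of_mono_antitone (h : Crossing x y) (hx : Monotone x) (hy : Antitone y) : False :=
  h.not_le 0 le_rfl <| (hx zero_le_one).trans ((h.lt 1 le_rfl).le.trans (hy zero_le_one))

theorem false_of_strictAnti_const (hP : NoForbidden P) (h : Crossing x y) (hx : StrictAnti x)
    (hy : ∀ i j, y i = y j) : False := by
  refine hP.dual.f5 (containsCopy_F5 (p := OrderDual.toDual (y 0))
    (d := fun k : ℕ => OrderDual.toDual (x (-k))) (c := fun k : ℕ => OrderDual.toDual (x (k + 1)))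
    (fun i j hij => hx (by omega)) (fun i j hij => hx (by omega))
    (fun k hk => h.not_le (-k) (by omega) ?_) (fun k hk => h.not_ge (-k) ?_) ?_ ?_)
  · rw [hy _ 0]; exact hk
  · rw [hy _ 0]; exact hk
  · rw [hy 0 1]; exact h.lt 1 le_rfl
  · exact hx (by omega)

theorem finite_or_finite_of_antichain (hP : NoForbidden P) {p : P} (hy : AntichainSeq y)
    (hp : ∀ j, ¬ y j ≤ p) : {j | p ≤ y j}.Finite ∨ {j | ¬ p ≤ y j}.Finite := by
  by_contra! h
  obtain ⟨h1, h2⟩ := h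
  have e1 := h1.natEmbedding
  have e2 := h2.natEmbedding
  have hne (i k) : ((e1 i : ℤ)) ≠ e2 k := fun he => (e2 k).2 (he ▸ (e1 i).2)
  exact hP.f2 (containsCopy_F2 (p := p) (a := fun k => y (e2 k)) (b := fun k => y (e1 k))
    (hy.comp (Subtype.val_injective.comp e2.injective))
    (hy.comp (Subtype.val_injective.comp e1.injective))
    (fun i j hij => hne j i (hy _ _ hij).symm) (fun i j hij => hne i j (hy _ _ hij))
    (fun i => lt_of_le_not_ge (e1 i).2 (hp _)) (fun i => (e2 i).2) fun i => hp _)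

theorem false_of_antichain_const (hP : NoForbidden P) (h : Crossing x y) (hx : AntichainSeq x)
    (hy : ∀ i j, y i = y j) : False := by
  rcases hP.dual.finite_or_finite_of_antichain (p := OrderDual.toDual (y 0)) hx.dual
    (fun j hj => h.not_ge j (by rw [hy j 0]; exact hj)) with hf | hf
  · exact Set.infinite_of_injective_forall_mem (f := fun n : ℕ => (n + 1 : ℤ))
      (fun a b hab => by simpa using hab)
      (fun n => by
        change x _ ≤ y 0
        rw [hy 0 (n + 1)]
        exact (h.lt (n + 1) (by omega)).le) hf
  · exact Set.infinite_of_injective_forall_mem (f := fun n : ℕ => (-n : ℤ))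
      (fun a b hab => by simpa using hab)
      (fun n => by
        change ¬ x _ ≤ y 0
        rw [hy 0 (-n)]
        exact h.not_le (-n) (by omega)) hf

theorem false_of_strictMono_strictMono (hP : NoForbidden P) (h : Crossing x y)
    (hx : StrictMono x) (hy : StrictMono y) : False :=
  hP.false_of_ladder (a := fun k : ℕ => x (-k)) (b := fun k : ℕ => y (-k))
    (c := fun k : ℕ => y (k + 1)) (fun i j hij => hx (by omega)) (fun i j hij => hy (by omega))
    (fun i j hij => hy (by omega)) (fun i => h.not_le _ (by omega)) (fun i => h.not_ge _)
    ((hx (by omega : (-(0 : ℕ) : ℤ) < 1)).trans (by simpa using h.lt 1 le_rfl))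
    (hy (by omega))

theorem false_of_strictAnti_strictMono (hP : NoForbidden P) (h : Crossing x y)
    (hx : StrictAnti x) (hy : StrictMono y) : False := by
  have hyx (i j) : ¬ y j ≤ x i := fun hij => by
    obtain ⟨k, hi, hj, hle, -⟩ := h.exists_lt_of_le hij
    exact (h.lt 1 le_rfl).not_ge ((hy.monotone hj).trans (hle.trans (hx.antitone hi)))
  by_cases h01 : x 0 ≤ y 1
  · exact hP.f5 (containsCopy_F5 (p := x 0) (d := fun k : ℕ => y (-k))
      (c := fun k : ℕ => y (k + 1)) (fun i j hij => hy (by omega))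
      (fun i j hij => hy (by omega))
      (fun i hi => h.not_le 0 le_rfl (hi.trans (hy.monotone (by omega)))) (fun i => hyx _ _)
      (by simpa using lt_of_le_not_ge h01 (hyx _ _)) (hy (by omega)))
  · exact hP.dual.f5 (containsCopy_F5 (p := OrderDual.toDual (y 1))
      (d := fun k : ℕ => OrderDual.toDual (x (-k)))
      (c := fun k : ℕ => OrderDual.toDual (x (k + 1))) (fun i j hij => hx (by omega))
      (fun i j hij => hx (by omega)) (fun i hi => h01 ((hx.antitone (by omega)).trans hi))
      (fun i => hyx _ _)
      (show x ((0 : ℕ) + 1) < y 1 by simpa using h.lt 1 le_rfl) (hx (by omega)))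

theorem false_of_strictMono_antichain (hP : NoForbidden P) (h : Crossing x y)
    (hx : StrictMono x) (hy : AntichainSeq y) : False :=
  hP.dual.f4 (containsCopy_F4 (a := fun k : ℕ => OrderDual.toDual (y (k + 1)))
    (c := fun k : ℕ => OrderDual.toDual (x (1 - k)))
    (hy.dual.comp (g := fun k : ℕ => (k + 1 : ℤ)) fun a b hab => by simpa using hab)
    (fun i j hij => hx (by omega))
    fun i => (hx.monotone (by omega)).trans_lt (h.lt (i + 1) (by omega)))

theorem false_of_antichain_strictMono (hP : NoForbidden P) (h : Crossing x y)
    (hx : AntichainSeq x) (hy : StrictMono y) : False := by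
  by_cases hyx : ∃ i j, y j ≤ x i
  · obtain ⟨i, j, hij⟩ := hyx
    exact hP.dual.f4 (containsCopy_F4 (a := fun k : ℕ => OrderDual.toDual (x (i + k)))
      (c := fun k : ℕ => OrderDual.toDual (y (j - k - 1)))
      (hx.dual.comp (g := fun k : ℕ => (i + k : ℤ)) fun a b hab => by simpa using hab)
      (fun i j hij => hy (by omega))
      fun k => (hy (by omega : j - (0 : ℕ) - 1 < j + k)).trans_le
        (h.shifts'.le j i k (by omega) hij))
  · push Not at hyx
    exact hP.false_of_antichain_chain (a := fun k : ℕ => x k) (c := fun k : ℕ => y k)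
      (hx.comp (g := fun k : ℕ => (k : ℤ)) Nat.cast_injective) (fun i j hij => hy (by omega))
      fun i j => hyx _ _

/-- If one element of the lower antichain is below cofinitely many elements of the upper one, then
every element of the upper antichain is above cofinitely many elements of the lower one. -/
theorem finite_of_exists_finite (hP : NoForbidden P) (hs : Shifts x y) (hx : AntichainSeq x)
    (hyx : ∀ i j, ¬ y j ≤ x i) {i₀ : ℤ} (hi₀ : {j | ¬ x i₀ ≤ y j}.Finite) (j : ℤ) :
    {i | ¬ x i ≤ y j}.Finite := by
  obtain ⟨K, hK⟩ := hi₀.bddBelow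
  refine (hP.dual.finite_or_finite_of_antichain (p := OrderDual.toDual (y j)) hx.dual
    fun i => hyx i j).resolve_left fun hf => ?_
  refine Set.infinite_of_injective_forall_mem (f := fun n : ℕ => (i₀ + (|j - K| + n + 1) : ℤ))
    (fun a b hab => by simpa using hab) (fun n => ?_) hf
  change x _ ≤ y j
  have h1 : x i₀ ≤ y (j - (|j - K| + n + 1)) := by
    by_contra hn
    have := hK (show j - (|j - K| + n + 1) ∈ {j | ¬ x i₀ ≤ y j} from hn)
    have := le_abs_self (j - K)
    omega
  simpa using hs.le _ _ (|j - K| + n + 1) (by positivity) h1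

theorem false_of_antichain_antichain (hP : NoForbidden P) (h : Crossing x y)
    (hx : AntichainSeq x) (hy : AntichainSeq y) : False := by
  have hyx (i j) : ¬ y j ≤ x i := fun hij => by
    obtain ⟨k, -, -, -, hlt⟩ := h.exists_lt_of_le hij
    exact hlt.ne (congrArg y (hy _ _ hlt.le))
  have hX (i) := hP.finite_or_finite_of_antichain (p := x i) hy (hyx i)
  have hY (j) := hP.dual.finite_or_finite_of_antichain (p := OrderDual.toDual (y j)) hx.dual
    fun i => hyx i j
  have hXY {i₀} (h₀ : {j | ¬ x i₀ ≤ y j}.Finite) (j) : {i | ¬ x i ≤ y j}.Finite :=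
    hP.finite_of_exists_finite h.shifts hx hyx h₀ j
  have hYX {j₀} (h₀ : {i | ¬ x i ≤ y j₀}.Finite) (i) : {j | ¬ x i ≤ y j}.Finite :=
    hP.dual.finite_of_exists_finite h.shifts.dual hy.dual (fun i j => hyx j i) h₀ i
  by_cases hcof : ∃ i, {j | ¬ x i ≤ y j}.Finite
  · obtain ⟨i₀, h₀⟩ := hcof
    have hj := hXY h₀
    have hi := hYX (hj 0)
    obtain ⟨g, hg, hgQ⟩ := exists_strictMono_forall_lt_not
      (Q := fun i j => ¬ x (-i) ≤ y (-j) ∨ ¬ x (-j) ≤ y (-i)) fun i =>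
        ((hi (-i)).preimage (f := fun n : ℕ => (-n : ℤ)) fun a _ b _ hab => by simpa using hab).union
        ((hj (-i)).preimage (f := fun n : ℕ => (-n : ℤ)) fun a _ b _ hab => by simpa using hab)
    simp only [not_or, not_not] at hgQ
    have hE (i j) : x (-g i) ≤ y (-g j) ↔ i ≠ j := by
      refine ⟨fun hle he => h.not_le (-g i) (by omega) (he ▸ hle), fun hne => ?_⟩
      rcases hne.lt_or_gt with hlt | hlt
      · exact (hgQ _ _ hlt).1
      · exact (hgQ _ _ hlt).2
    have hinj : Function.Injective fun n => (-g n : ℤ) := fun a b hab =>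
      hg.injective (by simpa using hab)
    exact hP.f8 (containsCopy_F8
      (a := fun i : ℤ => x (-g (if 0 < i then 3 * i.natAbs + 1 else 3 * i.natAbs)))
      (b := fun i : ℤ => y (-g (if 0 < i then 3 * i.natAbs + 2 else 3 * i.natAbs)))
      (fun i j hij => by
        have := hinj (hx _ _ hij)
        split_ifs at this <;> omega)
      (fun i j hij => by
        have := hinj (hy _ _ hij)
        split_ifs at this <;> omega)
      (fun i j => (hE _ _).trans (by split_ifs <;> omega)) fun i j => hyx _ _)
  · push Not at hcof
    have hi (i) := (hX i).resolve_right (hcof i)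
    have hj (j) := (hY j).resolve_right fun hf => hcof 0 (hYX hf 0)
    have hinj : Function.Injective fun n : ℕ => (n + 1 : ℤ) := fun a b hab => by simpa using hab
    obtain ⟨g, hg, hgQ⟩ := exists_strictMono_forall_lt_not
      (Q := fun i j => x (i + 1) ≤ y (j + 1) ∨ x (j + 1) ≤ y (i + 1)) fun i =>
        ((hi (i + 1)).preimage (f := fun n : ℕ => (n + 1 : ℤ)) hinj.injOn).union
        ((hj (i + 1)).preimage (f := fun n : ℕ => (n + 1 : ℤ)) hinj.injOn)
    simp only [not_or] at hgQ
    have hE (i j) : x (g i + 1) ≤ y (g j + 1) ↔ i = j := by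
      refine ⟨fun hle => ?_, fun he => he ▸ (h.lt (g i + 1) (by omega)).le⟩
      by_contra hne
      rcases Ne.lt_or_gt hne with hlt | hlt
      · exact (hgQ _ _ hlt).1 hle
      · exact (hgQ _ _ hlt).2 hle
    have hinj' : Function.Injective fun n => (g n + 1 : ℤ) := hinj.comp hg.injective
    have hodd : Function.Injective fun n : ℕ => 2 * n + 1 := fun a b hab => by simpa using hab
    have heven : Function.Injective fun n : ℕ => 2 * n := fun a b hab => by simpa using hab
    exact hP.f3 (containsCopy_F3 (a := fun k => y (g (2 * k) + 1))
      (x := fun k => x (g (2 * k + 1) + 1)) (y := fun k => y (g (2 * k + 1) + 1))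
      (hy.comp (hinj'.comp heven)) (hx.comp (hinj'.comp hodd)) (hy.comp (hinj'.comp hodd))
      (fun i j => hyx _ _) (fun i j hij => by have := (hE _ _).1 hij; omega)
      (fun i j hij => by have := hinj' (hy _ _ hij); omega)
      (fun i j hij => by have := hinj' (hy _ _ hij); omega)
      (fun i j => (hE _ _).trans (by omega)) fun i j => hyx _ _)

end NoForbidden

/-- A sequence that is constant, a chain ordered like `ℤ` or its dual, or an antichain. -/
def Regular (x : ℤ → P) : Prop :=
  (∀ i j, x i = x j) ∨ StrictMono x ∨ StrictAnti x ∨ AntichainSeq x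

theorem NoForbidden.false_of_crossing (hP : NoForbidden P) (h : Crossing x y) (hx : Regular x)
    (hy : Regular y) : False := by
  rcases hx with hx | hx | hx | hx <;> rcases hy with hy | hy | hy | hy
  · exact false_of_const_const h hx hy
  · exact hP.dual.false_of_strictAnti_const h.dual hy.dual_right fun i j => hx i j
  · exact false_of_mono_antitone h (fun i j _ => (hx i j).le) hy.antitone
  · exact hP.dual.false_of_antichain_const h.dual hy.dual fun i j => hx i j
  · exact false_of_mono_antitone h hx.monotone (fun i j _ => (hy j i).le)
  · exact hP.false_of_strictMono_strictMono h hx hy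
  · exact false_of_mono_antitone h hx.monotone hy.antitone
  · exact hP.false_of_strictMono_antichain h hx hy
  · exact hP.false_of_strictAnti_const h hx hy
  · exact hP.false_of_strictAnti_strictMono h hx hy
  · exact hP.dual.false_of_strictMono_strictMono h.dual hy.dual_right hx.dual_right
  · exact hP.dual.false_of_antichain_strictMono h.dual hy.dual hx.dual_right
  · exact hP.false_of_antichain_const h hx hy
  · exact hP.false_of_antichain_strictMono h hx hy
  · exact hP.dual.false_of_strictMono_antichain h.dual hy.dual_right hx.dual
  · exact hP.false_of_antichain_antichain h hx hy

theorem NoForbidden.lt_add_of_lt (hP : NoForbidden P) (hz : Shifts z z) {i j : ℤ} (hij : i < j)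
    (h : z i < z j) (n : ℤ) : z n < z (n + (j - i)) := by
  have hmono := hP.strictMono_of_shifts (hz.comp_affine i (j - i) (by omega)) (by simpa using h)
  have hk : 0 ≤ n - (i + (j - i) * -|n - i|) := by
    have h1 : |n - i| ≤ (j - i) * |n - i| := le_mul_of_one_le_left (abs_nonneg _) (by omega)
    have := neg_abs_le (n - i)
    rw [mul_neg]
    omega
  have := hz.lt _ _ _ hk (hmono (lt_add_one (-|n - i|)))
  ring_nf at this ⊢
  exact this

theorem strictMono_mul_of_lt_add {d : ℤ} (h : ∀ n, z n < z (n + d)) {m : ℤ} (hm : 0 < m) :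
    StrictMono fun n => z (d * m * n) := by
  have hd : StrictMono fun n => z (d * n) := strictMono_int_of_lt_succ fun n => by
    simpa [mul_add] using h (d * n)
  simpa [Function.comp_def, mul_assoc] using hd.comp (strictMono_mul_left_of_pos hm)

end

section Orbits

variable {P : Type*} [PartialOrder P] {f : Equiv.Perm P}

theorem shifts_orbit (hf : Monotone f) (u v : P) :
    Shifts (fun n : ℤ => (f ^ n) u) (fun n : ℤ => (f ^ n) v) := by
  have hmono (k : ℤ) (hk : 0 ≤ k) : StrictMono (f ^ k) := by
    lift k to ℕ using hk
    rw [zpow_natCast, Equiv.Perm.coe_pow]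
    exact (hf.strictMono_of_injective f.injective).iterate k
  refine ⟨fun i j k hk h => ?_, fun i j k hk h => ?_⟩
  · simpa [add_comm _ k, zpow_add] using (hmono k hk).monotone h
  · simpa [add_comm _ k, zpow_add] using hmono k hk h

theorem NoForbidden.exists_regular (hP : NoForbidden P) (hf : Monotone f) (u : P) :
    ∃ d : ℤ, 0 < d ∧ ∀ m : ℤ, 0 < m → Regular fun n : ℤ => (f ^ (d * m * n)) u := by
  have hz := shifts_orbit hf u u
  by_cases hanti : AntichainSeq fun n : ℤ => (f ^ n) u
  · exact ⟨1, one_pos, fun m hm => .inr (.inr (.inr (hanti.comp (g := fun n => 1 * m * n)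
      fun a b hab => by simpa [hm.ne'] using hab)))⟩
  obtain ⟨i, j, hle, hne⟩ : ∃ i j : ℤ, (f ^ i) u ≤ (f ^ j) u ∧ i ≠ j := by
    simpa [AntichainSeq] using hanti
  rcases eq_or_lt_of_le hle with heq | hlt
  · have hfix : (f ^ (j - i)) u = u := by
      rw [sub_eq_neg_add, zpow_add, Equiv.Perm.mul_apply, ← heq, ← Equiv.Perm.mul_apply,
        ← zpow_add, neg_add_cancel, zpow_zero, Equiv.Perm.one_apply]
    have hfix' (n : ℤ) : (f ^ ((j - i) * n)) u = u := by
      rw [zpow_mul]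
      exact Equiv.Perm.zpow_apply_eq_self_of_apply_eq_self hfix n
    refine ⟨|j - i|, abs_pos.2 (sub_ne_zero.2 hne.symm), fun m hm => .inl ?_⟩
    have hconst (n : ℤ) : (f ^ (|j - i| * m * n)) u = u := by
      rcases abs_choice (j - i) with h | h <;> rw [h, mul_assoc]
      · exact hfix' _
      · rw [neg_mul_comm]
        exact hfix' _
    exact fun a b => (hconst a).trans (hconst b).symm
  · rcases hne.lt_or_gt with hij | hij
    · exact ⟨j - i, by omega, fun m hm =>
        .inr (.inl (strictMono_mul_of_lt_add (hP.lt_add_of_lt hz hij hlt) hm))⟩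
    · exact ⟨i - j, by omega, fun m hm => .inr (.inr (.inl fun a b hab =>
        strictMono_mul_of_lt_add (hP.dual.lt_add_of_lt hz.dual hij hlt) hm hab))⟩

theorem NoForbidden.reversible (hP : NoForbidden P) : Reversible P := by
  intro f hf a b hab
  by_contra hn
  set u := f.symm a with hu
  set v := f.symm b with hv
  obtain ⟨d, hd, hdu⟩ := hP.exists_regular hf u
  obtain ⟨e, he, hev⟩ := hP.exists_regular hf v
  have hde : 0 < d * e := mul_pos hd he
  have hlt : (f ^ (1 : ℤ)) u < (f ^ (1 : ℤ)) v := by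
    simpa [hu, hv] using lt_of_le_of_ne hab fun h => hn (by rw [hu, hv, h])
  have hs := shifts_orbit hf u v
  have hcross : Crossing (fun n : ℤ => (f ^ (d * e * n)) u) (fun n : ℤ => (f ^ (d * e * n)) v) :=
    { shifts := by simpa using hs.comp_affine 0 (d * e) hde.le
      shifts' := by simpa using (shifts_orbit hf v u).comp_affine 0 (d * e) hde.le
      lt := fun n hn => by
        have h1 : 1 ≤ d * e * n := by have := mul_pos hde (by omega : 0 < n); omega
        simpa using hs.lt 1 1 (d * e * n - 1) (by omega) hlt
      not_le := fun n hn' h => by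
        have h1 : d * e * n ≤ 0 := mul_nonpos_of_nonneg_of_nonpos hde.le hn'
        exact hn (by simpa using hs.le _ _ (-(d * e * n)) (by omega) h) }
  exact hP.false_of_crossing hcross (hdu e he) (by simpa [mul_comm d e] using hev d hd)

end Orbits

/-- Corollary 2: a poset with no subset isomorphic to any `Fᵢ` or `Fᵢᵒᵈ`,
`i = 1, …, 8`, is hereditarily reversible. -/
theorem hereditarily_reversible_of_no_forbidden_subset (P : Type*) [PartialOrder P]
    (h1 : ¬ ContainsCopy F1 P) (h1d : ¬ ContainsCopy F1ᵒᵈ P)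
    (h2 : ¬ ContainsCopy F2 P) (h2d : ¬ ContainsCopy F2ᵒᵈ P)
    (h3 : ¬ ContainsCopy F3 P) (h3d : ¬ ContainsCopy F3ᵒᵈ P)
    (h4 : ¬ ContainsCopy F4 P) (h4d : ¬ ContainsCopy F4ᵒᵈ P)
    (h5 : ¬ ContainsCopy F5 P) (h5d : ¬ ContainsCopy F5ᵒᵈ P)
    (h6 : ¬ ContainsCopy F6 P) (h6d : ¬ ContainsCopy F6ᵒᵈ P)
    (h7 : ¬ ContainsCopy F7 P) (h7d : ¬ ContainsCopy F7ᵒᵈ P)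
    (h8 : ¬ ContainsCopy F8 P) (h8d : ¬ ContainsCopy F8ᵒᵈ P) :
    ∀ S : Set P, Reversible S := by
  exact fun S => (NoForbidden.mk h1 h1d h2 h2d h3 h3d h4 h4d h5 h5d h6 h6d h7 h7d h8 h8d).subset S
    |>.reversible
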